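/- arXiv:2102.04769 — 8 statements merged into one kernel-verified Lean document; each statement's English description precedes it below -/
import Mathlib

section
/- Let F be a finite field and let h, m ≥ 1 be natural numbers. Let b, c ∈ F^h be nonzero vectors and let v, u ∈ F^m be distinct vectors such that v ≠ a•u for every nonzero a ∈ F. Then the number of matrices A ∈ F^{h×m} satisfying bᵀAv = cᵀAu is exactly |F|^{hm−1}; equivalently, for a uniformly random matrix A ∈ F^{h×m}, the probability that bᵀAv = cᵀAu equals 1/|F|. -/
open Matrix Finset Classical

/-- The linear functional `A ↦ bᵀAv - cᵀAu` on matrices. -/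
def bilinDiff {F ι κ : Type*} [Field F] [Fintype ι] [Fintype κ]
    (b c : ι → F) (v u : κ → F) : Module.Dual F (Matrix ι κ F) where
  toFun A := b ⬝ᵥ (A *ᵥ v) - c ⬝ᵥ (A *ᵥ u)
  map_add' A B := by simp only [Matrix.add_mulVec, dotProduct_add]; ring
  map_smul' a A := by
    simp only [Matrix.smul_mulVec, dotProduct_smul, smul_eq_mul, RingHom.id_apply]; ring

theorem bilinDiff_single {F ι κ : Type*} [Field F] [Fintype ι] [Fintype κ] [DecidableEq ι]
    [DecidableEq κ] (b c : ι → F) (v u : κ → F) (i : ι) (j : κ) :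
    bilinDiff b c v u (Matrix.single i j 1) = b i * v j - c i * u j := by
  simp [bilinDiff, Matrix.single_mulVec, dotProduct, Function.update_apply]

theorem bilinDiff_ne_zero {F ι κ : Type*} [Field F] [Fintype ι] [Fintype κ]
    {b c : ι → F} (hb : b ≠ 0) (hc : c ≠ 0) {v u : κ → F} (hvu : v ≠ u)
    (hva : ∀ a : F, a ≠ 0 → v ≠ a • u) : bilinDiff b c v u ≠ 0 := by
  intro h0
  have key (i : ι) (j : κ) : b i * v j = c i * u j := by
    rw [← sub_eq_zero, ← bilinDiff_single, h0, LinearMap.zero_apply]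
  obtain ⟨i, hi⟩ := Function.ne_iff.mp hb
  obtain ⟨k, hk⟩ := Function.ne_iff.mp hc
  rw [Pi.zero_apply] at hi hk
  by_cases hci : c i = 0
  · have hv (j : κ) : v j = 0 := by simpa [hci, hi] using key i j
    have hu (j : κ) : u j = 0 := by simpa [hv j, hk] using (key k j).symm
    exact hvu (funext fun j => (hv j).trans (hu j).symm)
  · refine hva (c i / b i) (div_ne_zero hci hi) (funext fun j => ?_)
    rw [Pi.smul_apply, smul_eq_mul, div_mul_eq_mul_div, eq_div_iff hi, mul_comm, key]

/-- For a finite field `F`, nonzero `b c : F^h`, distinct `v u : F^m`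
with `v ≠ a • u` for every nonzero `a : F`, the number of matrices `A ∈ F^{h×m}` with
`bᵀAv = cᵀAu` is exactly `|F|^(h*m-1)`; equivalently the probability for a uniformly
random matrix is `1/|F|`. -/
theorem stmt0 (F : Type*) [Field F] [Fintype F]
    (h m : ℕ) (hh : 1 ≤ h) (hm : 1 ≤ m)
    (b c : Fin h → F) (hb : b ≠ 0) (hc : c ≠ 0)
    (v u : Fin m → F) (hvu : v ≠ u)
    (hva : ∀ a : F, a ≠ 0 → v ≠ a • u) :
    (Finset.univ.filter (fun A : Matrix (Fin h) (Fin m) F =>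
        b ⬝ᵥ (A *ᵥ v) = c ⬝ᵥ (A *ᵥ u))).card = Fintype.card F ^ (h * m - 1) ∧
    ((Finset.univ.filter (fun A : Matrix (Fin h) (Fin m) F =>
        b ⬝ᵥ (A *ᵥ v) = c ⬝ᵥ (A *ᵥ u))).card : ℝ)
      / (Fintype.card (Matrix (Fin h) (Fin m) F) : ℝ) = 1 / (Fintype.card F : ℝ) := by
  have hcard : (Finset.univ.filter (fun A : Matrix (Fin h) (Fin m) F =>
      b ⬝ᵥ (A *ᵥ v) = c ⬝ᵥ (A *ᵥ u))).card = Fintype.card F ^ (h * m - 1) := by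
    have hrank := Module.Dual.finrank_ker_add_one_of_ne_zero (bilinDiff_ne_zero hb hc hvu hva)
    rw [Module.finrank_matrix, Module.finrank_self, Fintype.card_fin, Fintype.card_fin,
      mul_one] at hrank
    rw [← hrank, Nat.add_sub_cancel, ← Module.card_eq_pow_finrank, ← Fintype.card_subtype]
    refine Fintype.card_congr (Equiv.subtypeEquivRight fun A => ?_)
    rw [LinearMap.mem_ker]
    exact sub_eq_zero.symm
  refine ⟨hcard, ?_⟩
  have hF : (Fintype.card F : ℝ) ≠ 0 := Nat.cast_ne_zero.mpr Fintype.card_ne_zero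
  have htotal : Fintype.card (Matrix (Fin h) (Fin m) F)
      = Fintype.card F ^ (h * m - 1) * Fintype.card F := by
    rw [← pow_succ, Nat.sub_add_cancel (Nat.mul_pos hh hm),
      Module.card_eq_pow_finrank (K := F), Module.finrank_matrix]
    simp
  rw [hcard, htotal]
  push_cast
  field_simp
end

section
/- Let F be a finite field, let h, m, ℓ ≥ 1, and let V be a finite set of vectors in F^m all of whose coordinates lie in {0,1} ⊆ F. If |V|² · |F|^h · (1/|F|)^ℓ < 1/10, then for independent uniformly random matrices A_1, …, A_ℓ ∈ F^{h×m}, with probability at least 9/10 it holds that f(α, v) ≠ f(α, u) for every pair of distinct vectors v, u ∈ V and every nonzero α ∈ F^h. -/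
open Matrix Finset Classical

/-- `f(α, v) = (αᵀA_1v, …, αᵀA_ℓv) ∈ F^ℓ`. -/
def fMap {F : Type*} [Field F] {h m ℓ : ℕ} (A : Fin ℓ → Matrix (Fin h) (Fin m) F)
    (α : Fin h → F) (v : Fin m → F) : Fin ℓ → F :=
  fun j => α ⬝ᵥ (A j *ᵥ v)

/-- The linear map `A ↦ f(α, v)`. -/
def fMapLinear {F : Type*} [Field F] {h m : ℕ} (ℓ : ℕ) (α : Fin h → F) (v : Fin m → F) :
    (Fin ℓ → Matrix (Fin h) (Fin m) F) →ₗ[F] (Fin ℓ → F) where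
  toFun A := fMap A α v
  map_add' A B := by
    ext j
    simp [fMap, Matrix.add_mulVec, dotProduct_add]
  map_smul' c A := by
    ext j
    simp [fMap, Matrix.smul_mulVec, dotProduct_smul]

lemma fMap_sub {F : Type*} [Field F] {h m ℓ : ℕ} (A : Fin ℓ → Matrix (Fin h) (Fin m) F)
    (α : Fin h → F) (v u : Fin m → F) : fMap A α (v - u) = fMap A α v - fMap A α u := by
  ext j
  simp [fMap, Matrix.mulVec_sub, dotProduct_sub]

lemma fMapLinear_surjective {F : Type*} [Field F] {h m : ℕ} (ℓ : ℕ) {α : Fin h → F}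
    {v : Fin m → F} (hα : α ≠ 0) (hv : v ≠ 0) : Function.Surjective (fMapLinear ℓ α v) := by
  obtain ⟨i, hi⟩ := Function.ne_iff.mp hα
  obtain ⟨k, hk⟩ := Function.ne_iff.mp hv
  simp only [Pi.zero_apply] at hi hk
  intro y
  refine ⟨fun j => Matrix.single i k ((α i)⁻¹ * y j * (v k)⁻¹), ?_⟩
  ext j
  simp only [fMapLinear, fMap, LinearMap.coe_mk, AddHom.coe_mk, Matrix.single_mulVec,
    ← Pi.single.eq_1, dotProduct_single]
  field_simp

lemma card_fMap_eq_zero_mul {F : Type*} [Field F] [Fintype F] {h m : ℕ} (ℓ : ℕ)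
    {α : Fin h → F} {v : Fin m → F} (hα : α ≠ 0) (hv : v ≠ 0) :
    (univ.filter fun A : Fin ℓ → Matrix (Fin h) (Fin m) F => fMap A α v = 0).card *
      Fintype.card F ^ ℓ = Fintype.card (Fin ℓ → Matrix (Fin h) (Fin m) F) := by
  have key := Submodule.card_eq_card_quotient_mul_card (LinearMap.ker (fMapLinear ℓ α v))
  rw [Nat.card_congr
    ((fMapLinear ℓ α v).quotKerEquivOfSurjective (fMapLinear_surjective ℓ hα hv)).toEquiv] at key
  have hker : Nat.card (LinearMap.ker (fMapLinear (F := F) ℓ α v)) =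
      (univ.filter fun A : Fin ℓ → Matrix (Fin h) (Fin m) F => fMap A α v = 0).card := by
    rw [← Fintype.card_subtype, ← Nat.card_eq_fintype_card]
    rfl
  rw [hker, Nat.card_eq_fintype_card, Nat.card_eq_fintype_card] at key
  simp only [key, Fintype.card_fun, Fintype.card_fin]

/-- Let `V` be a finite set of 0-1 vectors in `F^m`. If
`|V|² · |F|^h · (1/|F|)^ℓ < 1/10`, then for independent uniformly random matrices
`A_1, …, A_ℓ ∈ F^{h×m}`, with probability at least `9/10`, `f(α,v) ≠ f(α,u)` for all
distinct `v, u ∈ V` and nonzero `α ∈ F^h`. -/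
theorem stmt2 (F : Type*) [Field F] [Fintype F]
    (h m ℓ : ℕ) (hh : 1 ≤ h) (hm : 1 ≤ m) (hℓ : 1 ≤ ℓ)
    (V : Finset (Fin m → F)) (hV : ∀ v ∈ V, ∀ i, v i = 0 ∨ v i = 1)
    (hcond : (V.card : ℝ) ^ 2 * (Fintype.card F : ℝ) ^ h
        * (1 / (Fintype.card F : ℝ)) ^ ℓ < 1 / 10) :
    (9 / 10 : ℝ) * (Fintype.card (Fin ℓ → Matrix (Fin h) (Fin m) F) : ℝ) ≤
      ((Finset.univ.filter (fun A : Fin ℓ → Matrix (Fin h) (Fin m) F =>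
          ∀ v ∈ V, ∀ u ∈ V, v ≠ u → ∀ α : Fin h → F, α ≠ 0 →
            fMap A α v ≠ fMap A α u)).card : ℝ) := by
  set N := Fintype.card (Fin ℓ → Matrix (Fin h) (Fin m) F) with hN
  set q := Fintype.card F with hq
  have hq0 : (0 : ℝ) < q := by exact_mod_cast Fintype.card_pos
  set good := univ.filter (fun A : Fin ℓ → Matrix (Fin h) (Fin m) F =>
    ∀ v ∈ V, ∀ u ∈ V, v ≠ u → ∀ α : Fin h → F, α ≠ 0 → fMap A α v ≠ fMap A α u) with hgood
  set T := ((V ×ˢ V) ×ˢ (univ : Finset (Fin h → F))).filter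
    (fun t => t.1.1 ≠ t.1.2 ∧ t.2 ≠ 0) with hT
  have hsub : goodᶜ ⊆ T.biUnion (fun t => univ.filter
      fun A : Fin ℓ → Matrix (Fin h) (Fin m) F => fMap A t.2 (t.1.1 - t.1.2) = 0) := by
    intro A hA
    simp only [hgood, mem_compl, mem_filter, mem_univ, true_and] at hA
    push Not at hA
    obtain ⟨v, hv, u, hu, hvu, α, hα, he⟩ := hA
    refine mem_biUnion.mpr ⟨((v, u), α), ?_, ?_⟩
    · simp [hT, hv, hu, hvu, hα]
    · simp [fMap_sub, he]
  have hbad : ((goodᶜ).card : ℝ) ≤ T.card * (N * (1 / (q : ℝ)) ^ ℓ) := by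
    calc ((goodᶜ).card : ℝ) ≤ ∑ t ∈ T, ((univ.filter
          fun A : Fin ℓ → Matrix (Fin h) (Fin m) F =>
            fMap A t.2 (t.1.1 - t.1.2) = 0).card : ℝ) := by
          exact_mod_cast (card_le_card hsub).trans card_biUnion_le
      _ = ∑ t ∈ T, (N * (1 / (q : ℝ)) ^ ℓ) := by
          refine sum_congr rfl fun t ht => ?_
          obtain ⟨hne, hα⟩ := (mem_filter.mp ht).2
          rw [hN, ← card_fMap_eq_zero_mul ℓ hα (sub_ne_zero.mpr hne)]
          rw [Nat.cast_mul, Nat.cast_pow, mul_assoc, ← mul_pow, mul_one_div_cancel hq0.ne', one_pow,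
            mul_one]
      _ = T.card * (N * (1 / (q : ℝ)) ^ ℓ) := by rw [sum_const, nsmul_eq_mul]
  have hTcard : (T.card : ℝ) ≤ (V.card : ℝ) ^ 2 * (q : ℝ) ^ h := by
    have hle := card_filter_le ((V ×ˢ V) ×ˢ (univ : Finset (Fin h → F)))
      (fun t => t.1.1 ≠ t.1.2 ∧ t.2 ≠ 0)
    rw [card_product, card_product, card_univ, Fintype.card_fun, Fintype.card_fin, ← sq] at hle
    exact_mod_cast hle
  have htotal : (good.card : ℝ) + (goodᶜ).card = N := by
    exact_mod_cast card_add_card_compl good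
  have hbound : ((goodᶜ).card : ℝ) ≤ 1 / 10 * N :=
    calc ((goodᶜ).card : ℝ) ≤ T.card * (N * (1 / (q : ℝ)) ^ ℓ) := hbad
      _ ≤ ((V.card : ℝ) ^ 2 * (q : ℝ) ^ h) * (N * (1 / (q : ℝ)) ^ ℓ) := by gcongr
      _ = ((V.card : ℝ) ^ 2 * (q : ℝ) ^ h * (1 / (q : ℝ)) ^ ℓ) * N := by ring
      _ ≤ 1 / 10 * N := by gcongr
  linarith
end

section
/- Let F be a finite field of characteristic 2, let h, m, ℓ ≥ 1, and let V be a finite set of vectors in F^m all of whose coordinates lie in {0,1} ⊆ F. If |V|³ · |F|^{2h} · (1/|F|)^ℓ < 1/10, then for independent uniformly random matrices A_1, …, A_ℓ ∈ F^{h×m}, with probability at least 9/10 it holds that f(α, v) + f(α′, u) ≠ f(α + α′, w) for all pairwise distinct vectors v, u, w ∈ V and all nonzero α, α′ ∈ F^h. -/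
open Matrix Finset Classical

/-- At most a `|F|^(-ℓ)` fraction of the `ℓ`-tuples lie in the kernel of a nonzero functional. -/
lemma card_filter_forall_eq_zero_mul_le {F M : Type*} [Field F] [Fintype F] [AddCommGroup M]
    [Module F M] [Fintype M] (ℓ : ℕ) (φ : M →ₗ[F] F) (hφ : φ ≠ 0) :
    (univ.filter fun A : Fin ℓ → M => ∀ k, φ (A k) = 0).card * Fintype.card F ^ ℓ ≤
      Fintype.card (Fin ℓ → M) := by
  obtain ⟨e, he⟩ : ∃ e, φ e ≠ 0 := by
    by_contra! H
    exact hφ (LinearMap.ext H)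
  have hcard : Fintype.card F ^ ℓ = (univ : Finset (Fin ℓ → F)).card := by simp
  rw [hcard, ← card_product, ← card_univ]
  refine card_le_card_of_injOn (fun p k => p.1 k + p.2 k • e) (fun _ _ => by simp) ?_
  rintro ⟨A, s⟩ hA ⟨B, t⟩ hB hAB
  simp only [coe_product, Set.mem_prod, mem_coe, mem_filter, mem_univ, true_and, and_true]
    at hA hB
  have hst : s = t := by
    funext k
    have := congrArg φ (congrFun hAB k)
    simpa [hA k, hB k, he] using this
  subst hst
  have hA_eq : A = B := by
    funext k
    simpa using congrFun hAB k
  rw [hA_eq]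

/-- The functional `M ↦ αᵀMv + α′ᵀMu - (α + α′)ᵀMw`. -/
def relationFunctional {F : Type*} [Field F] {h m : ℕ} (α α' : Fin h → F) (v u w : Fin m → F) :
    Matrix (Fin h) (Fin m) F →ₗ[F] F where
  toFun M := α ⬝ᵥ (M *ᵥ v) + α' ⬝ᵥ (M *ᵥ u) - (α + α') ⬝ᵥ (M *ᵥ w)
  map_add' M N := by
    simp only [add_mulVec, dotProduct_add]
    ring
  map_smul' c M := by
    simp only [smul_mulVec, dotProduct_smul, smul_eq_mul, RingHom.id_apply]
    ring

lemma relationFunctional_ne_zero {F : Type*} [Field F] {h m : ℕ} {α α' : Fin h → F}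
    {v u w : Fin m → F} (hv : ∀ i, v i = 0 ∨ v i = 1) (hu : ∀ i, u i = 0 ∨ u i = 1)
    (hw : ∀ i, w i = 0 ∨ w i = 1) (hvu : v ≠ u) (hα : α ≠ 0) (hα' : α' ≠ 0) :
    relationFunctional α α' v u w ≠ 0 := by
  intro H
  obtain ⟨j, hj⟩ := Function.ne_iff.mp hvu
  obtain ⟨i, hi⟩ := Function.ne_iff.mp hα
  obtain ⟨i', hi'⟩ := Function.ne_iff.mp hα'
  have key : ∀ i, α i * v j + α' i * u j - (α i + α' i) * w j = 0 := fun i => by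
    simpa [relationFunctional, single_mulVec, ← Pi.single.eq_1, add_mul]
      using LinearMap.congr_fun H (Matrix.single i j 1)
  have h1 := key i
  have h2 := key i'
  rcases hv j with hv | hv <;> rcases hu j with hu | hu <;> rcases hw j with hw | hw <;>
    simp_all

/-- Each fixed instance of the relation holds for at most a `|F|^(-ℓ)` fraction of the tuples. -/
lemma card_filter_fMap_add_eq_mul_le {F : Type*} [Field F] [Fintype F] {h m : ℕ} (ℓ : ℕ)
    {α α' : Fin h → F} {v u w : Fin m → F} (hv : ∀ i, v i = 0 ∨ v i = 1)
    (hu : ∀ i, u i = 0 ∨ u i = 1) (hw : ∀ i, w i = 0 ∨ w i = 1) (hvu : v ≠ u)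
    (hα : α ≠ 0) (hα' : α' ≠ 0) :
    (univ.filter fun A : Fin ℓ → Matrix (Fin h) (Fin m) F =>
      fMap A α v + fMap A α' u = fMap A (α + α') w).card * Fintype.card F ^ ℓ ≤
      Fintype.card (Fin ℓ → Matrix (Fin h) (Fin m) F) := by
  convert card_filter_forall_eq_zero_mul_le ℓ _
    (relationFunctional_ne_zero hv hu hw hvu hα hα') using 4 with A
  simp [funext_iff, fMap, relationFunctional, sub_eq_zero]

/-- Let `F` be a finite field of characteristic 2 and `V` a finite set of
0-1 vectors in `F^m`. If `|V|³ · |F|^(2h) · (1/|F|)^ℓ < 1/10`, then for independent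
uniformly random matrices `A_1, …, A_ℓ ∈ F^{h×m}`, with probability at least `9/10`,
`f(α,v) + f(α′,u) ≠ f(α+α′,w)` for all pairwise distinct `v, u, w ∈ V` and all nonzero
`α, α′ ∈ F^h`. -/
theorem stmt3 (F : Type*) [Field F] [Fintype F] [CharP F 2]
    (h m ℓ : ℕ) (hh : 1 ≤ h) (hm : 1 ≤ m) (hℓ : 1 ≤ ℓ)
    (V : Finset (Fin m → F)) (hV : ∀ v ∈ V, ∀ i, v i = 0 ∨ v i = 1)
    (hcond : (V.card : ℝ) ^ 3 * (Fintype.card F : ℝ) ^ (2 * h)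
        * (1 / (Fintype.card F : ℝ)) ^ ℓ < 1 / 10) :
    (9 / 10 : ℝ) * (Fintype.card (Fin ℓ → Matrix (Fin h) (Fin m) F) : ℝ) ≤
      ((Finset.univ.filter (fun A : Fin ℓ → Matrix (Fin h) (Fin m) F =>
          ∀ v ∈ V, ∀ u ∈ V, ∀ w ∈ V, v ≠ u → u ≠ w → v ≠ w →
            ∀ α α' : Fin h → F, α ≠ 0 → α' ≠ 0 →
              fMap A α v + fMap A α' u ≠ fMap A (α + α') w)).card : ℝ) := by
  set N := Fintype.card (Fin ℓ → Matrix (Fin h) (Fin m) F) with hN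
  set q := Fintype.card F with hq
  have hq0 : (0 : ℝ) < q := by exact_mod_cast Fintype.card_pos
  set good := fun A : Fin ℓ → Matrix (Fin h) (Fin m) F =>
    ∀ v ∈ V, ∀ u ∈ V, ∀ w ∈ V, v ≠ u → u ≠ w → v ≠ w →
      ∀ α α' : Fin h → F, α ≠ 0 → α' ≠ 0 → fMap A α v + fMap A α' u ≠ fMap A (α + α') w
    with hgood
  let I := ((V ×ˢ V ×ˢ V) ×ˢ (univ : Finset ((Fin h → F) × (Fin h → F)))).filter
    fun p => p.1.1 ≠ p.1.2.1 ∧ p.2.1 ≠ 0 ∧ p.2.2 ≠ 0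
  let bad := fun p : ((Fin m → F) × (Fin m → F) × (Fin m → F)) × ((Fin h → F) × (Fin h → F)) =>
    univ.filter fun A : Fin ℓ → Matrix (Fin h) (Fin m) F =>
      fMap A p.2.1 p.1.1 + fMap A p.2.2 p.1.2.1 = fMap A (p.2.1 + p.2.2) p.1.2.2
  have hI : (I.card : ℝ) ≤ (V.card : ℝ) ^ 3 * (q : ℝ) ^ (2 * h) := by
    have hle : I.card ≤ V.card ^ 3 * q ^ (2 * h) := by
      refine (card_filter_le _ _).trans_eq ?_
      simp only [card_product, card_univ, Fintype.card_prod, Fintype.card_fun, Fintype.card_fin]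
      ring
    exact_mod_cast hle
  have hbad : ∀ p ∈ I, ((bad p).card : ℝ) ≤ N * (1 / (q : ℝ)) ^ ℓ := by
    rintro ⟨⟨v, u, w⟩, α, α'⟩ hp
    simp only [I, mem_filter, mem_product, mem_univ, and_true] at hp
    obtain ⟨⟨hv, hu, hw⟩, hvu, hα, hα'⟩ := hp
    rw [one_div, inv_pow, ← div_eq_mul_inv, le_div_iff₀ (by positivity)]
    exact_mod_cast card_filter_fMap_add_eq_mul_le ℓ (hV v hv) (hV u hu) (hV w hw) hvu hα hα'
  have hsub : univ.filter (fun A => ¬ good A) ⊆ I.biUnion bad := by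
    intro A hA
    simp only [hgood, mem_filter, mem_univ, true_and] at hA
    push Not at hA
    obtain ⟨v, hv, u, hu, w, hw, hvu, -, -, α, α', hα, hα', heq⟩ := hA
    exact mem_biUnion.mpr ⟨((v, u, w), α, α'), by simp [I, *], by simp [bad, heq]⟩
  have hcompl : ((univ.filter fun A => ¬ good A).card : ℝ) ≤ 1 / 10 * N := by
    calc ((univ.filter fun A => ¬ good A).card : ℝ)
        ≤ ((∑ p ∈ I, (bad p).card : ℕ) : ℝ) := by
          exact_mod_cast (card_le_card hsub).trans card_biUnion_le
      _ ≤ ∑ _p ∈ I, (N : ℝ) * (1 / (q : ℝ)) ^ ℓ := by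
          push_cast
          exact sum_le_sum hbad
      _ = I.card * (N * (1 / (q : ℝ)) ^ ℓ) := by rw [sum_const, nsmul_eq_mul]
      _ ≤ (V.card : ℝ) ^ 3 * (q : ℝ) ^ (2 * h) * (N * (1 / (q : ℝ)) ^ ℓ) := by gcongr
      _ = (V.card : ℝ) ^ 3 * (q : ℝ) ^ (2 * h) * (1 / (q : ℝ)) ^ ℓ * N := by ring
      _ ≤ 1 / 10 * N := by gcongr
  have htotal : ((univ.filter good).card : ℝ) + (univ.filter fun A => ¬ good A).card = N := by
    exact_mod_cast card_filter_add_card_filter_not (s := univ) good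
  linarith
end

section
/- Let F be a field of characteristic 2, m ≥ 1, and let v, u, w ∈ F^m be pairwise distinct vectors all of whose coordinates lie in {0,1} ⊆ F. Then for every nonzero a ∈ F, w − u ≠ a•(v − w). -/
/-- Let `F` be a field of characteristic 2 and `v, u, w ∈ F^m` pairwise
distinct vectors with all coordinates in `{0,1} ⊆ F`. Then for every nonzero `a ∈ F`,
`w − u ≠ a • (v − w)`. -/
theorem stmt5 (F : Type*) [Field F] [CharP F 2] (m : ℕ) (hm : 1 ≤ m)
    (v u w : Fin m → F)
    (hv : ∀ i, v i = 0 ∨ v i = 1) (hu : ∀ i, u i = 0 ∨ u i = 1)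
    (hw : ∀ i, w i = 0 ∨ w i = 1)
    (hvu : v ≠ u) (huw : u ≠ w) (hvw : v ≠ w) :
    ∀ a : F, a ≠ 0 → w - u ≠ a • (v - w) := by
  intro a ha h
  obtain ⟨i, hi⟩ := Function.ne_iff.mp hvw
  have a_eq_one : a = 1 := by
    have hc : w i - u i = a * (v i - w i) := congrFun h i
    rcases hv i with h1 | h1 <;> rcases hu i with h2 | h2 <;> rcases hw i with h3 | h3 <;>
      simp_all [CharTwo.neg_eq]
  apply hvu
  funext j
  have hc : w j - u j = a * (v j - w j) := congrFun h j
  rw [a_eq_one, one_mul, CharTwo.sub_eq_add, CharTwo.sub_eq_add, add_comm (v j)] at hc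
  exact (add_left_cancel hc).symm
end

section
/- Let G and H be abelian groups with G finite and nonempty, let f : G → H be a function, and let δ be a real number with 0 < δ ≤ 1/4. If Pr_{x,y}[f(x) + f(y) = f(x + y)] ≥ 1 − δ/2, where x, y are independent and uniformly distributed in G, then there exists a group homomorphism g : G → H such that Pr_x[f(x) = g(x)] ≥ 1 − δ for x uniformly distributed in G. -/
open Finset Classical

/-- If at least a `c` fraction of pairs collide under `k`, then some value of `k` is taken on at
least a `c` fraction of points. -/
theorem exists_le_card_fiber_of_le_card_collisions {α β : Type*} [Fintype α] [Nonempty α]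
    (k : α → β) (c : ℝ)
    (h : c * (Fintype.card α : ℝ) ^ 2 ≤ ((univ.filter fun p : α × α => k p.2 = k p.1).card : ℝ)) :
    ∃ b, c * (Fintype.card α : ℝ) ≤ ((univ.filter fun y => k y = b).card : ℝ) := by
  have hsum : ((univ.filter fun p : α × α => k p.2 = k p.1).card : ℝ)
      = ∑ y : α, ((univ.filter fun z => k z = k y).card : ℝ) := by
    simp only [card_filter, Fintype.sum_prod_type, Nat.cast_sum]
  obtain ⟨y, -, hy⟩ := exists_le_of_sum_le (s := (univ : Finset α))
    (f := fun _ => c * (Fintype.card α : ℝ))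
    (g := fun y => ((univ.filter fun z => k z = k y).card : ℝ)) univ_nonempty (by
      rw [← hsum, sum_const, nsmul_eq_mul, card_univ]
      linarith)
  exact ⟨k y, hy⟩

/-- The shift differences `f (x + y) - f y` collide for all but twice the number of pairs at which
`f` fails to be additive. -/
theorem card_shift_collisions {G H : Type*} [AddCommGroup G] [AddCommGroup H] [Fintype G]
    (f : G → H) (x : G) :
    Fintype.card (G × G) ≤
      (univ.filter fun p : G × G => f (x + p.2) - f p.2 = f (x + p.1) - f p.1).card
        + 2 * (univ.filter fun p : G × G => ¬ f p.1 + f p.2 = f (p.1 + p.2)).card := by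
  set B := univ.filter fun p : G × G => ¬ f p.1 + f p.2 = f (p.1 + p.2)
  have h1 : (univ.filter fun p : G × G => (x + p.1, p.2) ∈ B).card ≤ B.card :=
    card_le_card_of_injOn (fun p => (x + p.1, p.2)) (fun p hp => by simpa using hp)
      (fun p _ q _ h => by simpa [Prod.ext_iff] using h)
  have h2 : (univ.filter fun p : G × G => (x + p.2, p.1) ∈ B).card ≤ B.card :=
    card_le_card_of_injOn (fun p => (x + p.2, p.1)) (fun p hp => by simpa using hp)
      (fun p _ q _ h => by simpa [Prod.ext_iff, and_comm] using h)
  have hcover : (univ : Finset (G × G)) ⊆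
      (univ.filter fun p : G × G => f (x + p.2) - f p.2 = f (x + p.1) - f p.1) ∪
        ((univ.filter fun p : G × G => (x + p.1, p.2) ∈ B) ∪
          univ.filter fun p : G × G => (x + p.2, p.1) ∈ B) := by
    rintro ⟨y, z⟩ -
    simp only [B, mem_union, mem_filter, mem_univ, true_and]
    by_contra! hne
    obtain ⟨hne, hy, hz⟩ := hne
    apply hne
    rw [sub_eq_sub_iff_add_eq_add, hz, hy, add_right_comm]
  have h3 := card_le_card hcover
  have h4 := card_union_le
    (univ.filter fun p : G × G => f (x + p.2) - f p.2 = f (x + p.1) - f p.1)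
    ((univ.filter fun p : G × G => (x + p.1, p.2) ∈ B) ∪
      univ.filter fun p : G × G => (x + p.2, p.1) ∈ B)
  have h5 := card_union_le (univ.filter fun p : G × G => (x + p.1, p.2) ∈ B)
    (univ.filter fun p : G × G => (x + p.2, p.1) ∈ B)
  rw [card_univ] at h3
  omega

/-- A function agreeing, at each `x`, with at least three quarters of the shift differences
`f (x + y) - f y` is additive. -/
theorem map_add_of_le_card_shift {G H : Type*} [AddCommGroup G] [AddCommGroup H] [Fintype G]
    (f g : G → H)
    (hg : ∀ x, 3 / 4 * (Fintype.card G : ℝ) ≤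
      ((univ.filter fun y => f (x + y) - f y = g x).card : ℝ)) (a b : G) :
    g (a + b) = g a + g b := by
  have hbad : ∀ x, ((univ.filter fun y => ¬ f (x + y) - f y = g x).card : ℝ)
      ≤ 1 / 4 * Fintype.card G := fun x => by
    have h : ((univ.filter fun y => f (x + y) - f y = g x).card : ℝ)
        + ((univ.filter fun y => ¬ f (x + y) - f y = g x).card : ℝ) = Fintype.card G := by
      exact_mod_cast card_filter_add_card_filter_not (s := univ) fun y => f (x + y) - f y = g x
    linarith [hg x]
  have hshift : (univ.filter fun y => ¬ f (a + (b + y)) - f (b + y) = g a).card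
      ≤ (univ.filter fun y => ¬ f (a + y) - f y = g a).card :=
    card_le_card_of_injOn (fun y => b + y) (fun y hy => by simpa using hy)
      (fun y _ z _ h => by simpa using h)
  have hpos : (0 : ℝ) < Fintype.card G := by exact_mod_cast Fintype.card_pos
  by_contra hne
  have hcover : (univ : Finset G) ⊆
      (univ.filter fun y => ¬ f (a + (b + y)) - f (b + y) = g a) ∪
        ((univ.filter fun y => ¬ f (b + y) - f y = g b) ∪
          univ.filter fun y => ¬ f (a + b + y) - f y = g (a + b)) := by
    intro y _
    simp only [mem_union, mem_filter, mem_univ, true_and]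
    by_contra! h
    obtain ⟨ha, hb, hab⟩ := h
    apply hne
    rw [← ha, ← hb, ← hab, sub_add_sub_cancel, add_assoc]
  have h1 : (Fintype.card G : ℝ) ≤
      (univ.filter fun y => ¬ f (a + (b + y)) - f (b + y) = g a).card +
        ((univ.filter fun y => ¬ f (b + y) - f y = g b).card +
          (univ.filter fun y => ¬ f (a + b + y) - f y = g (a + b)).card) := by
    exact_mod_cast (card_le_card hcover).trans
      ((card_union_le _ _).trans (Nat.add_le_add_left (card_union_le _ _) _))
  have h2 : ((univ.filter fun y => ¬ f (a + (b + y)) - f (b + y) = g a).card : ℝ)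
      ≤ (univ.filter fun y => ¬ f (a + y) - f y = g a).card := by exact_mod_cast hshift
  linarith [hbad a, hbad b, hbad (a + b)]

/-- Each point where `f` differs from the popular shift difference `g` contributes at least a `c`
fraction of failures of additivity. -/
theorem mul_card_ne_le_card_not_additive {G H : Type*} [AddCommGroup G] [AddCommGroup H]
    [Fintype G] (f g : G → H) (c : ℝ)
    (hg : ∀ x, c * (Fintype.card G : ℝ) ≤
      ((univ.filter fun y => f (x + y) - f y = g x).card : ℝ)) :
    c * (Fintype.card G : ℝ) * ((univ.filter fun x => ¬ f x = g x).card : ℝ) ≤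
      ((univ.filter fun p : G × G => ¬ f p.1 + f p.2 = f (p.1 + p.2)).card : ℝ) := by
  have hsum : ((univ.filter fun p : G × G => ¬ f p.1 + f p.2 = f (p.1 + p.2)).card : ℝ)
      = ∑ x : G, ((univ.filter fun y => ¬ f x + f y = f (x + y)).card : ℝ) := by
    simp only [card_filter, Fintype.sum_prod_type, Nat.cast_sum]
  rw [hsum, mul_comm, ← nsmul_eq_mul, ← sum_const]
  refine (sum_le_sum fun x hx => ?_).trans
    (sum_le_sum_of_subset_of_nonneg (subset_univ _) fun _ _ _ => Nat.cast_nonneg _)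
  refine (hg x).trans (Nat.cast_le.mpr (card_le_card fun y hy => ?_))
  simp only [mem_filter, mem_univ, true_and] at hx hy ⊢
  intro h
  exact hx (by rw [← hy, ← h, add_sub_cancel_right])

/-- **linearity test / BLR.** Let `G`, `H` be abelian groups with `G` finite
and nonempty, `f : G → H`, and `0 < δ ≤ 1/4`. If the fraction of pairs `(x,y) ∈ G × G`
with `f(x) + f(y) = f(x+y)` is at least `1 − δ/2`, then there is a group homomorphism
`g : G → H` agreeing with `f` on at least a `1 − δ` fraction of `G`. -/
theorem stmt6 (G H : Type*) [AddCommGroup G] [AddCommGroup H] [Fintype G] [Nonempty G]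
    (f : G → H) (δ : ℝ) (hδ0 : 0 < δ) (hδ : δ ≤ 1 / 4)
    (hf : (1 - δ / 2) * (Fintype.card (G × G) : ℝ) ≤
        ((Finset.univ.filter (fun p : G × G => f p.1 + f p.2 = f (p.1 + p.2))).card : ℝ)) :
    ∃ g : G →+ H,
      (1 - δ) * (Fintype.card G : ℝ) ≤
        ((Finset.univ.filter (fun x : G => f x = g x)).card : ℝ) := by
  have hpos : (0 : ℝ) < Fintype.card G := by exact_mod_cast Fintype.card_pos
  have hcard : (Fintype.card (G × G) : ℝ) = (Fintype.card G : ℝ) ^ 2 := by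
    rw [Fintype.card_prod, Nat.cast_mul, sq]
  have hsplit : ((univ.filter fun p : G × G => f p.1 + f p.2 = f (p.1 + p.2)).card : ℝ)
      + ((univ.filter fun p : G × G => ¬ f p.1 + f p.2 = f (p.1 + p.2)).card : ℝ)
      = Fintype.card (G × G) := by
    exact_mod_cast card_filter_add_card_filter_not (s := univ)
      fun p : G × G => f p.1 + f p.2 = f (p.1 + p.2)
  have hbad : ((univ.filter fun p : G × G => ¬ f p.1 + f p.2 = f (p.1 + p.2)).card : ℝ)
      ≤ δ / 2 * (Fintype.card G : ℝ) ^ 2 := by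
    rw [hcard] at hf hsplit
    linarith
  have hpop : ∀ x, ∃ b, (1 - δ) * (Fintype.card G : ℝ) ≤
      ((univ.filter fun y => f (x + y) - f y = b).card : ℝ) := fun x => by
    refine exists_le_card_fiber_of_le_card_collisions (fun y => f (x + y) - f y) (1 - δ) ?_
    have h : (Fintype.card (G × G) : ℝ) ≤
        (univ.filter fun p : G × G => f (x + p.2) - f p.2 = f (x + p.1) - f p.1).card
          + 2 * (univ.filter fun p : G × G => ¬ f p.1 + f p.2 = f (p.1 + p.2)).card := by
      exact_mod_cast card_shift_collisions f x
    rw [hcard] at h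
    linarith
  choose g hg using hpop
  have hg' : ∀ x, 3 / 4 * (Fintype.card G : ℝ) ≤
      ((univ.filter fun y => f (x + y) - f y = g x).card : ℝ) := fun x =>
    (mul_le_mul_of_nonneg_right (by linarith) hpos.le).trans (hg x)
  refine ⟨AddMonoidHom.mk' g (map_add_of_le_card_shift f g hg'), ?_⟩
  have hne := (mul_card_ne_le_card_not_additive f g _ hg').trans hbad
  have hagree : ((univ.filter fun x => f x = g x).card : ℝ)
      + ((univ.filter fun x => ¬ f x = g x).card : ℝ) = Fintype.card G := by
    exact_mod_cast card_filter_add_card_filter_not (s := univ) fun x => f x = g x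
  have hle : 3 / 4 * ((univ.filter fun x => ¬ f x = g x).card : ℝ)
      ≤ δ / 2 * Fintype.card G := by
    refine le_of_mul_le_mul_left ?_ hpos
    linarith
  have hδn : 0 < δ * (Fintype.card G : ℝ) := mul_pos hδ0 hpos
  simp only [AddMonoidHom.mk'_apply]
  linarith
end

section
/- Let F be a finite field, let d ≥ 1, let N ≥ 1, let C_1, …, C_N ∈ F^d be nonzero vectors, and let ℓ be a natural number with |F|^ℓ > N. Then there exist vectors A_1, …, A_ℓ ∈ F^d such that for every index i ∈ {1,…,N} there exists j ∈ {1,…,ℓ} with A_j · C_i ≠ 0. -/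
open Matrix Finset

/-- The linear map sending a family of vectors to the family of their dot products with `c`. -/
def dotProductFamily (F : Type*) [Field F] {ι κ : Type*} [Fintype κ] (c : κ → F) :
    (ι → κ → F) →ₗ[F] (ι → F) where
  toFun A j := A j ⬝ᵥ c
  map_add' A B := by ext j; simp [add_dotProduct]
  map_smul' a A := by ext j; simp [smul_dotProduct]

theorem dotProductFamily_surjective {F : Type*} [Field F] {ι κ : Type*} [Fintype κ]
    {c : κ → F} (hc : c ≠ 0) :
    Function.Surjective (dotProductFamily F (ι := ι) c) := by
  classical
  obtain ⟨k, hk⟩ := Function.ne_iff.mp hc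
  intro y
  refine ⟨fun j => Pi.single k (y j / c k), ?_⟩
  ext j
  simpa [dotProductFamily] using div_mul_cancel₀ (y j) hk

theorem index_ker_dotProductFamily {F : Type*} [Field F] [Fintype F] {ι κ : Type*}
    [Fintype ι] [Fintype κ] {c : κ → F} (hc : c ≠ 0) :
    (dotProductFamily F (ι := ι) c).toAddMonoidHom.ker.index =
      Fintype.card F ^ Fintype.card ι := by
  classical
  rw [AddSubgroup.index_ker,
    AddMonoidHom.range_eq_top.mpr (dotProductFamily_surjective hc), AddSubgroup.card_top]
  simp

/-- Let `F` be a finite field, `C_1, …, C_N ∈ F^d` nonzero vectors, and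
`ℓ` with `|F|^ℓ > N`. Then there exist vectors `A_1, …, A_ℓ ∈ F^d` such that for every
`i` there is `j` with `A_j · C_i ≠ 0`. -/
theorem stmt10 (F : Type*) [Field F] [Fintype F]
    (d N ℓ : ℕ) (hd : 1 ≤ d) (hN : 1 ≤ N)
    (C : Fin N → Fin d → F) (hC : ∀ i, C i ≠ 0)
    (hℓ : N < Fintype.card F ^ ℓ) :
    ∃ A : Fin ℓ → Fin d → F, ∀ i : Fin N, ∃ j : Fin ℓ, A j ⬝ᵥ C i ≠ 0 := by
  by_contra! h
  obtain ⟨i, -, -, hi⟩ := AddSubgroup.exists_index_le_card_of_leftCoset_cover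
    (s := Finset.univ) (g := fun _ : Fin N => (0 : Fin ℓ → Fin d → F))
    (H := fun i => (dotProductFamily F (C i)).toAddMonoidHom.ker) <| by
      refine Set.eq_univ_of_forall fun A => ?_
      obtain ⟨i, hi⟩ := h A
      simp only [Set.mem_iUnion]
      exact ⟨i, Finset.mem_univ i, A, funext hi, zero_add A⟩
  rw [index_ker_dotProductFamily (hC i)] at hi
  simp only [Fintype.card_fin, Finset.card_univ] at hi
  omega
end

section
/- Let k ≥ 2, let G be a simple graph whose vertex set is partitioned into parts V_1, …, V_k, let d ≥ 1, and let σ : V(G) → F_2^d be an injective map with σ(v) ≠ 0 for every vertex v. Let fb be a bijection from the set of 2-element subsets of {1,…,k} to {1,…,k(k−1)/2}. In F_2^{k + k(k−1)/2 + k²d}, define: for each edge e = {v,u} of G with v ∈ V_i, u ∈ V_j (i ≠ j), the vector w_e which is zero on the first k coordinates, has a single 1 at position fb({i,j}) of the next k(k−1)/2 coordinates, and in the final k²d coordinates (viewed as k blocks of kd coordinates, each block itself divided into k sub-blocks of d coordinates) equals σ(v) on sub-block j of block i, equals σ(u) on sub-block i of block j, and is zero elsewhere; for each vertex v ∈ V_i,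 the vector w_v which has a single 1 at position i of the first k coordinates, is zero on the next k(k−1)/2 coordinates, and in the final k²d coordinates equals σ(v) on every sub-block j ≠ i of block i and is zero elsewhere; and the target t which is all-ones on the first k + k(k−1)/2 coordinates and zero on the final k²d coordinates. Then the following are equivalent: (1) there exist vertices v_1 ∈ V_1, …, v_k ∈ V_k that are pairwise adjacent in G; (2) there exist an edge e_{ij} of G between V_i and V_j for every 2-element subset {i,j} of {1,…,k}, and a vertex u_i ∈ V_i for every i ∈ {1,…,k}, such that Σ_{\{i,j\}} w_{e_{ij}} + Σ_{i} w_{u_i} = t in F_2^{k + k(k−1)/2 + k²d}. -/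
open Finset

/-- Coordinates of the ambient space `F₂^(k + k(k−1)/2 + k²d)`: a block of `k`
coordinates, a block of `k(k−1)/2` coordinates, and `k` blocks of `k·d` coordinates
(block `a`, sub-block `b`, coordinate `r` within a sub-block of length `d`). -/
abbrev Coord (k d : ℕ) := Fin k ⊕ (Fin (k * (k - 1) / 2) ⊕ Fin k × Fin k × Fin d)

/-- The vector `w_e` associated with an edge `e = {v,u}` with `v ∈ V_i`, `u ∈ V_j`
(`i ≠ j`), where `sv = σ(v)` and `su = σ(u)`: zero on the first `k` coordinates, a single
`1` at position `fb {i,j}` of the next `k(k−1)/2` coordinates, and in the last `k²d`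
coordinates `σ(v)` on sub-block `j` of block `i`, `σ(u)` on sub-block `i` of block `j`,
and zero elsewhere. -/
def wEdge {k d : ℕ} (fb : {s : Finset (Fin k) // s.card = 2} → Fin (k * (k - 1) / 2))
    (i j : Fin k) (hij : i ≠ j) (sv su : Fin d → ZMod 2) : Coord k d → ZMod 2
  | Sum.inl _ => 0
  | Sum.inr (Sum.inl p) => if p = fb ⟨{i, j}, Finset.card_pair hij⟩ then 1 else 0
  | Sum.inr (Sum.inr (a, b, r)) =>
      if a = i ∧ b = j then sv r else if a = j ∧ b = i then su r else 0

/-- The vector `w_v` associated with a vertex `v ∈ V_i`, where `sv = σ(v)`: a single `1`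
at position `i` of the first `k` coordinates, zero on the next `k(k−1)/2` coordinates,
and in the last `k²d` coordinates `σ(v)` on every sub-block `b ≠ i` of block `i` and
zero elsewhere. -/
def wVert {k d : ℕ} (i : Fin k) (sv : Fin d → ZMod 2) : Coord k d → ZMod 2
  | Sum.inl p => if p = i then 1 else 0
  | Sum.inr (Sum.inl _) => 0
  | Sum.inr (Sum.inr (a, b, r)) => if a = i ∧ b ≠ i then sv r else 0

/-- The target vector `t`: all-ones on the first `k + k(k−1)/2` coordinates, zero on the
last `k²d` coordinates. -/
def targetVec (k d : ℕ) : Coord k d → ZMod 2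
  | Sum.inl _ => 1
  | Sum.inr (Sum.inl _) => 1
  | Sum.inr (Sum.inr _) => 0

section VectorSum

variable {k d : ℕ}

theorem sum_wEdge_inl (fb : {s : Finset (Fin k) // s.card = 2} → Fin (k * (k - 1) / 2))
    (f g : {p : Fin k × Fin k // p.1 < p.2} → Fin d → ZMod 2) (q : Fin k) :
    (∑ p : {p : Fin k × Fin k // p.1 < p.2},
      wEdge fb p.1.1 p.1.2 (Fin.ne_of_lt p.2) (f p) (g p)) (Sum.inl q) = 0 := by
  simp [wEdge]

/-- Every position of the second block is hit by exactly one pair `i < j`. -/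
theorem sum_wEdge_inr_inl {fb : {s : Finset (Fin k) // s.card = 2} → Fin (k * (k - 1) / 2)}
    (hfb : Function.Bijective fb)
    (f g : {p : Fin k × Fin k // p.1 < p.2} → Fin d → ZMod 2) (q : Fin (k * (k - 1) / 2)) :
    (∑ p : {p : Fin k × Fin k // p.1 < p.2},
      wEdge fb p.1.1 p.1.2 (Fin.ne_of_lt p.2) (f p) (g p)) (Sum.inr (Sum.inl q)) = 1 := by
  obtain ⟨⟨s, hs⟩, rfl⟩ := hfb.2 q
  obtain ⟨a, b, hab, rfl⟩ : ∃ a b, a < b ∧ s = {a, b} := by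
    obtain ⟨a, b, hab, rfl⟩ := Finset.card_eq_two.1 hs
    rcases lt_or_gt_of_ne hab with h | h
    · exact ⟨a, b, h, rfl⟩
    · exact ⟨b, a, h, Finset.pair_comm a b⟩
  rw [Finset.sum_apply, Finset.sum_eq_single ⟨(a, b), hab⟩]
  · simp [wEdge]
  · rintro ⟨⟨i, j⟩, hij⟩ - hne
    refine if_neg fun h => hne ?_
    have hset : ({a, b} : Finset (Fin k)) = {i, j} := congrArg Subtype.val (hfb.1 h)
    have ha : a ∈ ({i, j} : Finset (Fin k)) := hset ▸ by simp
    have hb : b ∈ ({i, j} : Finset (Fin k)) := hset ▸ by simp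
    simp only [Finset.mem_insert, Finset.mem_singleton] at ha hb
    simp only at hij
    have : i = a ∧ j = b := by grind
    simp [this.1, this.2]
  · simp

theorem sum_wEdge_of_lt (fb : {s : Finset (Fin k) // s.card = 2} → Fin (k * (k - 1) / 2))
    (f g : {p : Fin k × Fin k // p.1 < p.2} → Fin d → ZMod 2) {a b : Fin k} (hab : a < b)
    (r : Fin d) :
    (∑ p : {p : Fin k × Fin k // p.1 < p.2},
      wEdge fb p.1.1 p.1.2 (Fin.ne_of_lt p.2) (f p) (g p)) (Sum.inr (Sum.inr (a, b, r))) =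
      f ⟨(a, b), hab⟩ r := by
  rw [Finset.sum_apply, Finset.sum_eq_single ⟨(a, b), hab⟩]
  · simp [wEdge]
  · rintro ⟨⟨i, j⟩, hij⟩ - hne
    simp only [ne_eq, Subtype.mk.injEq, Prod.mk.injEq] at hij hne
    simp only [wEdge]
    grind
  · simp

theorem sum_wEdge_of_gt (fb : {s : Finset (Fin k) // s.card = 2} → Fin (k * (k - 1) / 2))
    (f g : {p : Fin k × Fin k // p.1 < p.2} → Fin d → ZMod 2) {a b : Fin k} (hba : b < a)
    (r : Fin d) :
    (∑ p : {p : Fin k × Fin k // p.1 < p.2},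
      wEdge fb p.1.1 p.1.2 (Fin.ne_of_lt p.2) (f p) (g p)) (Sum.inr (Sum.inr (a, b, r))) =
      g ⟨(b, a), hba⟩ r := by
  rw [Finset.sum_apply, Finset.sum_eq_single ⟨(b, a), hba⟩]
  · simp [wEdge, hba.ne, hba.ne']
  · rintro ⟨⟨i, j⟩, hij⟩ - hne
    simp only [ne_eq, Subtype.mk.injEq, Prod.mk.injEq] at hij hne
    simp only [wEdge]
    grind
  · simp

theorem sum_wEdge_diag (fb : {s : Finset (Fin k) // s.card = 2} → Fin (k * (k - 1) / 2))
    (f g : {p : Fin k × Fin k // p.1 < p.2} → Fin d → ZMod 2) (a : Fin k) (r : Fin d) :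
    (∑ p : {p : Fin k × Fin k // p.1 < p.2},
      wEdge fb p.1.1 p.1.2 (Fin.ne_of_lt p.2) (f p) (g p)) (Sum.inr (Sum.inr (a, a, r))) = 0 := by
  rw [Finset.sum_apply]
  refine Finset.sum_eq_zero ?_
  rintro ⟨⟨i, j⟩, hij⟩ -
  simp only at hij
  simp only [wEdge]
  grind

theorem sum_wVert_inl (f : Fin k → Fin d → ZMod 2) (q : Fin k) :
    (∑ i, wVert i (f i)) (Sum.inl q) = 1 := by
  simp [wVert]

theorem sum_wVert_inr_inl (f : Fin k → Fin d → ZMod 2) (q : Fin (k * (k - 1) / 2)) :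
    (∑ i, wVert i (f i)) (Sum.inr (Sum.inl q)) = 0 := by
  simp [wVert]

theorem sum_wVert_inr_inr (f : Fin k → Fin d → ZMod 2) (a b : Fin k) (r : Fin d) :
    (∑ i, wVert i (f i)) (Sum.inr (Sum.inr (a, b, r))) = if b ≠ a then f a r else 0 := by
  rw [Finset.sum_apply, Finset.sum_eq_single a]
  · simp [wVert]
  · intro i _ hia
    simp [wVert, hia.symm]
  · simp

/-- The vectors sum to the target exactly when, for all `i < j`, the two endpoints of the edge
chosen for `{i, j}` carry the same labels as the vertices chosen in `V_i` and `V_j`. -/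
theorem sum_wEdge_add_sum_wVert_eq_targetVec_iff
    {fb : {s : Finset (Fin k) // s.card = 2} → Fin (k * (k - 1) / 2)}
    (hfb : Function.Bijective fb)
    (f g : {p : Fin k × Fin k // p.1 < p.2} → Fin d → ZMod 2) (h : Fin k → Fin d → ZMod 2) :
    (∑ p : {p : Fin k × Fin k // p.1 < p.2},
        wEdge fb p.1.1 p.1.2 (Fin.ne_of_lt p.2) (f p) (g p))
      + ∑ i : Fin k, wVert i (h i) = targetVec k d ↔
    ∀ p, f p = h p.1.1 ∧ g p = h p.1.2 := by
  constructor
  · rintro hsum ⟨⟨a, b⟩, hab⟩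
    simp only at hab
    constructor <;> funext r
    · have := congrFun hsum (Sum.inr (Sum.inr (a, b, r)))
      rw [Pi.add_apply, sum_wEdge_of_lt fb f g hab, sum_wVert_inr_inr, if_pos hab.ne'] at this
      exact CharTwo.add_eq_zero.1 this
    · have := congrFun hsum (Sum.inr (Sum.inr (b, a, r)))
      rw [Pi.add_apply, sum_wEdge_of_gt fb f g hab, sum_wVert_inr_inr, if_pos hab.ne] at this
      exact CharTwo.add_eq_zero.1 this
  · intro hfg
    funext c
    rw [Pi.add_apply]
    rcases c with q | q | ⟨a, b, r⟩
    · rw [sum_wEdge_inl, sum_wVert_inl, zero_add, targetVec]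
    · rw [sum_wEdge_inr_inl hfb, sum_wVert_inr_inl, add_zero, targetVec]
    · rw [sum_wVert_inr_inr, targetVec]
      rcases lt_trichotomy a b with hab | rfl | hab
      · rw [sum_wEdge_of_lt fb f g hab, if_pos hab.ne', (hfg _).1, CharTwo.add_self_eq_zero]
      · rw [sum_wEdge_diag, if_neg (not_not.2 rfl), add_zero]
      · rw [sum_wEdge_of_gt fb f g hab, if_pos hab.ne, (hfg _).2, CharTwo.add_self_eq_zero]

end VectorSum

/-- **correctness of the reduction from k-Multicolored-Clique to
Vector-Sum over `F₂`.** `G` has a multicolored `k`-clique (one vertex from each part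
`V_i = part⁻¹(i)`) iff one can pick an edge between `V_i` and `V_j` for each 2-element
subset `{i,j}` (represented by the ordered pair `i < j`) and a vertex in each `V_i` so
that the associated vectors sum to the target `t`. -/
theorem stmt11 {k d : ℕ} (hk : 2 ≤ k) (hd : 1 ≤ d)
    {V : Type*} [Fintype V] [DecidableEq V] (G : SimpleGraph V)
    (part : V → Fin k) (σ : V → Fin d → ZMod 2)
    (hσinj : Function.Injective σ) (hσ0 : ∀ v, σ v ≠ 0)
    (fb : {s : Finset (Fin k) // s.card = 2} → Fin (k * (k - 1) / 2))
    (hfb : Function.Bijective fb) :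
    (∃ vs : Fin k → V, (∀ i, part (vs i) = i) ∧
        ∀ i j, i ≠ j → G.Adj (vs i) (vs j)) ↔
    (∃ (ev eu : {p : Fin k × Fin k // p.1 < p.2} → V) (us : Fin k → V),
        (∀ p, G.Adj (ev p) (eu p) ∧ part (ev p) = p.1.1 ∧ part (eu p) = p.1.2) ∧
        (∀ i, part (us i) = i) ∧
        (∑ p : {p : Fin k × Fin k // p.1 < p.2},
            wEdge fb p.1.1 p.1.2 (Fin.ne_of_lt p.2) (σ (ev p)) (σ (eu p)))
          + ∑ i : Fin k, wVert i (σ (us i)) = targetVec k d) := by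
  constructor
  · rintro ⟨vs, hpart, hadj⟩
    refine ⟨fun p => vs p.1.1, fun p => vs p.1.2, vs,
      fun p => ⟨hadj _ _ (Fin.ne_of_lt p.2), hpart _, hpart _⟩, hpart, ?_⟩
    exact (sum_wEdge_add_sum_wVert_eq_targetVec_iff hfb _ _ fun i => σ (vs i)).2
      fun p => ⟨rfl, rfl⟩
  · rintro ⟨ev, eu, us, hedge, hpart, hsum⟩
    have hlabel := (sum_wEdge_add_sum_wVert_eq_targetVec_iff hfb (fun p => σ (ev p))
      (fun p => σ (eu p)) fun i => σ (us i)).1 hsum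
    have hadj : ∀ i j, i < j → G.Adj (us i) (us j) := fun i j hij => by
      have h := (hedge ⟨(i, j), hij⟩).1
      rwa [hσinj (hlabel ⟨(i, j), hij⟩).1, hσinj (hlabel ⟨(i, j), hij⟩).2] at h
    refine ⟨us, hpart, fun i j hij => ?_⟩
    rcases lt_or_gt_of_ne hij with h | h
    · exact hadj i j h
    · exact (hadj j i h).symm
end

section
/- Let F be a finite field, let h, m, ℓ, k ≥ 1, let A_1, …, A_ℓ ∈ F^{h×m} be matrices, let V_1, …, V_k be subsets of F^m, and let t ∈ F^m. Let X := (F^h)^k. Define the graph G′ as follows. Its vertex set is the disjoint union of: B-vertices, which are tuples (ᾱ, β̄, x, y, z) with ᾱ, β̄ ∈ X and x, y, z ∈ F^ℓ satisfying x = y + z, where such a vertex assigns value x to index ᾱ+β̄ (componentwise sum in X), value y to index ᾱ, and value z to index β̄; and A-vertices, which are tuples (ᾱ, i, x) with ᾱ ∈ X, i ∈ {1, …, |F|^{kh}}, and x ∈ F^ℓ, where such a vertex assigns value x to index ᾱ. Two distinct vertices of G′ are adjacent if and only if (a) their partial assignments agree on every index assigned by both, and (b) for the combined partial assignment σ of the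 two vertices, every (C2) and (C3) constraint both of whose indices are assigned by σ is satisfied, where: for i ∈ {1,…,k}, α ∈ F^h and ᾱ = (α_1,…,α_k) ∈ X, the (C2) constraint on the index pair ((α_1,…,α_i+α,…,α_k), ᾱ) requires σ(α_1,…,α_i+α,…,α_k) − σ(ᾱ) = f(α, v) for some v ∈ V_i; and for α ∈ F^h and ᾱ = (α_1,…,α_k) ∈ X, the (C3) constraint on the index pair ((α_1+α,…,α_k+α), ᾱ) requires σ(α_1+α,…,α_k+α) − σ(ᾱ) = f(α, t). If there exist v_1 ∈ V_1, …, v_k ∈ V_k with v_1 + ⋯ + v_k = t, then G′ contains a clique with exactly 2·|F|^{2kh} vertices. -/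
open Matrix Finset

/-- The index space `X = (F^h)^k`. -/
abbrev IdxSp (F : Type*) (h k : ℕ) := Fin k → Fin h → F

/-- B-vertices: tuples `((ᾱ, β̄), (x, y, z))` with `x = y + z`. -/
def BVert (F : Type*) [Field F] (h k ℓ : ℕ) :=
  {q : (IdxSp F h k × IdxSp F h k) × ((Fin ℓ → F) × (Fin ℓ → F) × (Fin ℓ → F)) //
    q.2.1 = q.2.2.1 + q.2.2.2}

/-- A-vertices: tuples `(ᾱ, i, x)` with `i ∈ {1, …, N}`. -/
def AVert (F : Type*) (h k ℓ N : ℕ) := IdxSp F h k × Fin N × (Fin ℓ → F)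

/-- Vertices of the graph `G′`. -/
def Vert (F : Type*) [Field F] (h k ℓ N : ℕ) := BVert F h k ℓ ⊕ AVert F h k ℓ N

/-- `assigns w i val` holds when the partial assignment of the vertex `w` assigns the
value `val` to the index `i`: a B-vertex `((ᾱ,β̄),(x,y,z))` assigns `x` to `ᾱ+β̄`, `y` to
`ᾱ` and `z` to `β̄`; an A-vertex `(ᾱ, i, x)` assigns `x` to `ᾱ`. -/
def assigns {F : Type*} [Field F] {h k ℓ N : ℕ} :
    Vert F h k ℓ N → IdxSp F h k → (Fin ℓ → F) → Prop
  | Sum.inl q, i, val =>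
      (i = q.1.1.1 + q.1.1.2 ∧ val = q.1.2.1) ∨
      (i = q.1.1.1 ∧ val = q.1.2.2.1) ∨
      (i = q.1.1.2 ∧ val = q.1.2.2.2)
  | Sum.inr a, i, val => i = a.1 ∧ val = a.2.2

/-- Adjacency in `G′`: two distinct vertices are adjacent iff (a) their partial
assignments agree on every index assigned by both, and (b) the combined partial
assignment satisfies every (C2) and (C3) constraint both of whose indices it assigns:
the (C2) constraint on `((α_1,…,α_i+α,…,α_k), ᾱ)` requires the difference of the values
to equal `f(α, v)` for some `v ∈ V_i`, and the (C3) constraint on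
`((α_1+α,…,α_k+α), ᾱ)` requires it to equal `f(α, t)`. -/
def AdjV {F : Type*} [Field F] {h m ℓ k N : ℕ} (A : Fin ℓ → Matrix (Fin h) (Fin m) F)
    (Vs : Fin k → Set (Fin m → F)) (t : Fin m → F)
    (w₁ w₂ : Vert F h k ℓ N) : Prop :=
  w₁ ≠ w₂ ∧
  (∀ (i : IdxSp F h k) (y₁ y₂ : Fin ℓ → F),
      assigns w₁ i y₁ → assigns w₂ i y₂ → y₁ = y₂) ∧
  (∀ (j : Fin k) (α : Fin h → F) (ᾱ : IdxSp F h k) (y' y : Fin ℓ → F),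
      (assigns w₁ (Function.update ᾱ j (ᾱ j + α)) y' ∨
        assigns w₂ (Function.update ᾱ j (ᾱ j + α)) y') →
      (assigns w₁ ᾱ y ∨ assigns w₂ ᾱ y) →
      ∃ v ∈ Vs j, y' - y = fMap A α v) ∧
  (∀ (α : Fin h → F) (ᾱ : IdxSp F h k) (y' y : Fin ℓ → F),
      (assigns w₁ (fun j => ᾱ j + α) y' ∨ assigns w₂ (fun j => ᾱ j + α) y') →
      (assigns w₁ ᾱ y ∨ assigns w₂ ᾱ y) →
      y' - y = fMap A α t)

section TupleVal

variable {F : Type*} [Field F] {h m ℓ k : ℕ} (A : Fin ℓ → Matrix (Fin h) (Fin m) F)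

theorem fMap_add_left (α β : Fin h → F) (v : Fin m → F) :
    fMap A (α + β) v = fMap A α v + fMap A β v := by
  ext j
  simp [fMap, add_dotProduct]

theorem fMap_sum_right {ι : Type*} (s : Finset ι) (α : Fin h → F) (v : ι → Fin m → F) :
    fMap A α (∑ i ∈ s, v i) = ∑ i ∈ s, fMap A α (v i) := by
  ext j
  simp [fMap, mulVec_sum, dotProduct_sum]

/-- The assignment `ᾱ ↦ ∑ i, f(α_i, v_i)` determined by a tuple of vectors `v`. -/
def tupleVal (v : Fin k → Fin m → F) (ᾱ : IdxSp F h k) : Fin ℓ → F :=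
  ∑ i, fMap A (ᾱ i) (v i)

theorem tupleVal_add (v : Fin k → Fin m → F) (x y : IdxSp F h k) :
    tupleVal A v (x + y) = tupleVal A v x + tupleVal A v y := by
  simp [tupleVal, fMap_add_left, Finset.sum_add_distrib]

theorem tupleVal_update_sub (v : Fin k → Fin m → F) (ᾱ : IdxSp F h k) (j : Fin k)
    (α : Fin h → F) :
    tupleVal A v (Function.update ᾱ j (ᾱ j + α)) - tupleVal A v ᾱ = fMap A α (v j) := by
  rw [tupleVal, tupleVal, ← Finset.sum_sub_distrib, Finset.sum_eq_single j]
  · simp [fMap_add_left]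
  · intro i _ hij
    simp [Function.update_of_ne hij]
  · simp

theorem tupleVal_translate_sub (v : Fin k → Fin m → F) (ᾱ : IdxSp F h k) (α : Fin h → F) :
    tupleVal A v (fun j => ᾱ j + α) - tupleVal A v ᾱ = fMap A α (∑ i, v i) := by
  simp [tupleVal, fMap_add_left, Finset.sum_add_distrib, fMap_sum_right]

/-- The vertices of `G′` whose partial assignment is the restriction of `tupleVal A v`: one
B-vertex for each pair of indices, and one A-vertex for each index and copy. -/
def tupleVertex (N : ℕ) (v : Fin k → Fin m → F) :
    (IdxSp F h k × IdxSp F h k) ⊕ (IdxSp F h k × Fin N) ↪ Vert F h k ℓ N where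
  toFun := Sum.map
    (fun p => (⟨(p, (tupleVal A v (p.1 + p.2), tupleVal A v p.1, tupleVal A v p.2)),
      tupleVal_add A v p.1 p.2⟩ : BVert F h k ℓ))
    (fun p => ((p.1, p.2, tupleVal A v p.1) : AVert F h k ℓ N))
  inj' := by
    refine Function.Injective.sumMap (fun p q hpq => ?_) (fun p q hpq => ?_)
    · exact congrArg (fun b : BVert F h k ℓ => b.1.1) hpq
    · exact congrArg (fun a : AVert F h k ℓ N => (a.1, a.2.1)) hpq

theorem eq_tupleVal_of_assigns {N : ℕ} {v : Fin k → Fin m → F}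
    {p : (IdxSp F h k × IdxSp F h k) ⊕ (IdxSp F h k × Fin N)} {i : IdxSp F h k}
    {y : Fin ℓ → F} (hy : assigns (tupleVertex A N v p) i y) : y = tupleVal A v i := by
  rcases p with p | p
  · rcases hy with ⟨rfl, rfl⟩ | ⟨rfl, rfl⟩ | ⟨rfl, rfl⟩ <;> rfl
  · rcases hy with ⟨rfl, rfl⟩
    rfl

theorem adjV_tupleVertex {N : ℕ} {Vs : Fin k → Set (Fin m → F)} {v : Fin k → Fin m → F}
    (hv : ∀ i, v i ∈ Vs i) {p q : (IdxSp F h k × IdxSp F h k) ⊕ (IdxSp F h k × Fin N)}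
    (hpq : tupleVertex A N v p ≠ tupleVertex A N v q) :
    AdjV A Vs (∑ i, v i) (tupleVertex A N v p) (tupleVertex A N v q) := by
  have eq_val {i : IdxSp F h k} {y : Fin ℓ → F}
      (hy : assigns (tupleVertex A N v p) i y ∨ assigns (tupleVertex A N v q) i y) :
      y = tupleVal A v i :=
    hy.elim (eq_tupleVal_of_assigns A) (eq_tupleVal_of_assigns A)
  refine ⟨hpq, fun i y₁ y₂ h₁ h₂ => ?_, fun j α ᾱ y' y h' h₀ => ⟨v j, hv j, ?_⟩,
    fun α ᾱ y' y h' h₀ => ?_⟩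
  · rw [eq_val (.inl h₁), eq_val (.inr h₂)]
  · rw [eq_val h', eq_val h₀, tupleVal_update_sub]
  · rw [eq_val h', eq_val h₀, tupleVal_translate_sub]

end TupleVal

/-- **completeness of the gap-clique instance.** If there are
`v_1 ∈ V_1, …, v_k ∈ V_k` with `v_1 + ⋯ + v_k = t`, then the graph `G′` (with A-vertex
copies indexed by `{1, …, |F|^{kh}}`) contains a clique with exactly `2·|F|^{2kh}`
vertices. -/
theorem stmt12 {F : Type*} [Field F] [Fintype F] {h m ℓ k : ℕ}
    (hh : 1 ≤ h) (hm : 1 ≤ m) (hℓ : 1 ≤ ℓ) (hk : 1 ≤ k)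
    (A : Fin ℓ → Matrix (Fin h) (Fin m) F)
    (Vs : Fin k → Set (Fin m → F)) (t : Fin m → F)
    (hsol : ∃ v : Fin k → Fin m → F, (∀ i, v i ∈ Vs i) ∧ ∑ i, v i = t) :
    ∃ S : Finset (Vert F h k ℓ (Fintype.card F ^ (k * h))),
      S.card = 2 * Fintype.card F ^ (2 * (k * h)) ∧
      ∀ w₁ ∈ S, ∀ w₂ ∈ S, w₁ ≠ w₂ → AdjV A Vs t w₁ w₂ := by
  classical
  obtain ⟨v, hv, rfl⟩ := hsol
  refine ⟨Finset.univ.map (tupleVertex A _ v), ?_, fun w₁ hw₁ w₂ hw₂ hne => ?_⟩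
  · have card_idx : Fintype.card (IdxSp F h k) = Fintype.card F ^ (k * h) := by
      simp [← pow_mul, mul_comm]
    rw [Finset.card_map, Finset.card_univ, Fintype.card_sum, Fintype.card_prod,
      Fintype.card_prod, Fintype.card_fin, card_idx]
    ring
  · obtain ⟨p, -, rfl⟩ := Finset.mem_map.mp hw₁
    obtain ⟨q, -, rfl⟩ := Finset.mem_map.mp hw₂
    exact adjV_tupleVertex A hv hne
end
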